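/- Let K be the discrete Kak-Hilbert transform on ℓ²(ℤ), defined by (K a)_k = (2/π)·Σ_{n even} a_n/(k−n) for k odd and (K a)_k = (2/π)·Σ_{n odd} a_n/(k−n) for k even. Then K∘K = −I, and consequently K is an isometry of ℓ²(ℤ). -/

import Mathlib

/-- The ℓ²-type norm of a sequence: `√(∑ |f m|²)`. -/
noncomputable def l2norm (f : ℤ → ℂ) : ℝ := Real.sqrt (∑' m : ℤ, ‖f m‖ ^ 2)

open scoped Classical in
/-- The Kak-Hilbert transform: `(K a)_k = (2/π)·∑_{n even} a_n/(k−n)` for `k` odd,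
and `(K a)_k = (2/π)·∑_{n odd} a_n/(k−n)` for `k` even. -/
noncomputable def Kop (a : ℤ → ℂ) (k : ℤ) : ℂ :=
  if Odd k then (2 / (Real.pi : ℂ)) * ∑' n : {n : ℤ // Even n}, a n.1 / ((k : ℂ) - (n.1 : ℂ))
  else (2 / (Real.pi : ℂ)) * ∑' n : {n : ℤ // Odd n}, a n.1 / ((k : ℂ) - (n.1 : ℂ))

lemma hs_congr {ι : Type*} {f g : ι → ℝ} {x y : ℝ} (h : HasSum f x) (hf : ∀ i, g i = f i)
    (hab : y = x) : HasSum g y := by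
  rw [hab, show g = f from funext hf]; exact h

lemma u_step : HasSum (fun i : ℤ => (1 / (2 * (i : ℝ) - 1) - 1 / (2 * (i : ℝ) + 1))) 0 := by
  have hlim : Filter.Tendsto (fun n : ℕ => 1 / (2 * (n : ℝ) + 1)) Filter.atTop (nhds 0) := by
    have h := (tendsto_one_div_add_atTop_nhds_zero_nat (𝕜 := ℝ)).comp
      (Filter.tendsto_id.const_mul_atTop' (show 0 < 2 by norm_num))
    refine h.congr fun n => ?_
    simp
  have key : HasSum (fun n : ℕ => 1 / (2 * (n : ℝ) + 1) - 1 / (2 * ((n + 1 : ℕ) : ℝ) + 1)) 1 := by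
    rw [hasSum_iff_tendsto_nat_of_nonneg]
    · simp_rw [Finset.sum_range_sub' (fun n : ℕ => 1 / (2 * (n : ℝ) + 1))]
      simpa using hlim.const_sub 1
    · intro n
      rw [sub_nonneg]
      apply one_div_le_one_div_of_le
      · positivity
      · push_cast; linarith
  have key2 : HasSum (fun n : ℕ => 1 / (2 * (n : ℝ) - 1) - 1 / (2 * (n : ℝ) + 1)) (-1) := by
    rw [← hasSum_nat_add_iff' 1]
    have : ∀ n : ℕ, (1 / (2 * (((n + 1 : ℕ)) : ℝ) - 1) - 1 / (2 * ((n + 1 : ℕ) : ℝ) + 1))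
        = 1 / (2 * (n : ℝ) + 1) - 1 / (2 * ((n + 1 : ℕ) : ℝ) + 1) := by
      intro n
      push_cast
      ring_nf
    simp_rw [this]
    refine hs_congr key (fun _ => rfl) ?_
    norm_num
  have := HasSum.of_nat_of_neg_add_one (f := fun i : ℤ => (1 / (2 * (i : ℝ) - 1) - 1 / (2 * (i : ℝ) + 1)))
    (m := -1) (m' := 1) (by simpa using key2) (by
      convert key using 2 with n
      push_cast
      rw [show 2 * (-((n : ℝ) + 1)) - 1 = -(2 * ((n : ℝ) + 1) + 1) by ring,
        show 2 * (-((n : ℝ) + 1)) + 1 = -(2 * (n : ℝ) + 1) by ring, one_div_neg_eq_neg_one_div,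
        one_div_neg_eq_neg_one_div]
      ring)
  simpa using this

noncomputable def uu (i : ℤ) : ℝ := 1 / (2 * (i : ℝ) + 1)

lemma uu_step (c : ℤ) : HasSum (fun i : ℤ => uu (i + c) - uu (i + (c + 1))) 0 := by
  have h := (Equiv.addRight (c + 1)).hasSum_iff.mpr u_step
  refine h.congr_fun ?_ |> id
  intro i
  simp only [uu, Function.comp, Equiv.coe_addRight]
  push_cast
  ring_nf

lemma uu_shift (e : ℤ) : HasSum (fun i : ℤ => uu i - uu (i + e)) 0 := by
  induction e using Int.induction_on with
  | zero => simpa using hasSum_zero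
  | succ n ih =>
    have := ih.add (uu_step n)
    simpa using this
  | pred n ih =>
    have := ih.sub (uu_step (-n - 1))
    simpa using this

lemma uu_ne (i : ℤ) : 2 * (i : ℝ) + 1 ≠ 0 := by
  intro h
  have : 2 * i + 1 = 0 := by exact_mod_cast h
  omega

lemma uu_mul (e : ℤ) (he : e ≠ 0) : HasSum (fun i : ℤ => uu i * uu (i + e)) 0 := by
  have h := (uu_shift e).mul_left (1 / (2 * (e : ℝ)))
  rw [mul_zero] at h
  refine hs_congr h (fun i => ?_) rfl
  have h1 := uu_ne i
  have h2 := uu_ne (i + e)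
  have h3 : (e : ℝ) ≠ 0 := by exact_mod_cast he
  unfold uu
  field_simp
  push_cast
  ring

lemma uu_sq : HasSum (fun i : ℤ => uu i * uu i) (Real.pi ^ 2 / 4) := by
  have hz := hasSum_zeta_two
  have he : HasSum (fun n : ℕ => 1 / ((2 * n : ℕ) : ℝ) ^ 2) (1 / 4 * (Real.pi ^ 2 / 6)) := by
    refine hs_congr (hz.mul_left (1 / 4)) (fun n => ?_) rfl
    push_cast
    rw [mul_pow, one_div_mul_one_div]; norm_num
  have ho : Summable (fun n : ℕ => 1 / ((2 * n + 1 : ℕ) : ℝ) ^ 2) :=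
    hz.summable.comp_injective (i := fun n : ℕ => 2 * n + 1) (fun a b h => by simpa using h)
  have hh := (he.even_add_odd (f := fun n : ℕ => 1 / (n : ℝ) ^ 2) ho.hasSum).unique hz
  have ho' : HasSum (fun n : ℕ => 1 / ((2 * n + 1 : ℕ) : ℝ) ^ 2) (Real.pi ^ 2 / 8) := by
    convert ho.hasSum using 1
    linarith
  have := HasSum.of_nat_of_neg_add_one (f := fun i : ℤ => uu i * uu i)
    (m := Real.pi ^ 2 / 8) (m' := Real.pi ^ 2 / 8) (by
      convert ho' using 2 with n
      unfold uu
      push_cast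
      rw [one_div_mul_one_div, sq]) (by
      convert ho' using 2 with n
      unfold uu
      push_cast
      rw [one_div_mul_one_div, sq]
      congr 1
      ring)
  convert this using 1
  ring

open scoped Classical in
noncomputable def rr (k n : ℤ) : ℝ := if Odd (k - n) then (2 / Real.pi) / ((k : ℝ) - n) else 0

lemma rr_symm (k n : ℤ) : rr n k = - rr k n := by
  unfold rr
  have : Odd (n - k) ↔ Odd (k - n) := by
    rw [← neg_sub, odd_neg]
  by_cases h : Odd (k - n)
  · rw [if_pos h, if_pos (this.2 h), ← div_neg, neg_sub]
  · rw [if_neg h, if_neg (this.not.2 h), neg_zero]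

lemma rr_orth (k l : ℤ) : HasSum (fun n => rr k n * rr l n) (if k = l then 1 else 0) := by
  by_cases hkl : Odd (l - k)
  · have : ∀ n, rr k n * rr l n = 0 := by
      intro n
      unfold rr
      by_cases h : Odd (k - n)
      · have : ¬ Odd (l - n) := by
          rw [Int.not_odd_iff_even]
          simpa using hkl.add_odd h
        simp [this]
      · simp [h]
    rw [if_neg (by rintro rfl; simp at hkl)]
    simpa [this] using hasSum_zero
  · obtain ⟨e, he⟩ := Int.not_odd_iff_even.1 hkl
    have hl : l = k + (e + e) := by omega
    subst hl
    have hinj : Function.Injective (fun i : ℤ => k - (2 * i + 1)) := fun a b h => by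
      simp at h; omega
    rw [← hinj.hasSum_iff]
    · have hval : ∀ i : ℤ, ((fun n => rr k n * rr (k + (e + e)) n) ∘ (fun i : ℤ => k - (2 * i + 1))) i
          = (4 / Real.pi ^ 2) * (uu i * uu (i + e)) := by
        intro i
        simp only [Function.comp, rr, uu]
        rw [if_pos ⟨i, by ring⟩, if_pos ⟨i + e, by ring⟩]
        push_cast
        rw [show (k : ℝ) - (k - (2 * i + 1)) = 2 * i + 1 by ring,
          show (k : ℝ) + (e + e) - (k - (2 * i + 1)) = 2 * (i + e) + 1 by ring]
        simp only [div_eq_mul_inv]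
        ring
      rw [show ((fun n => rr k n * rr (k + (e + e)) n) ∘ (fun i : ℤ => k - (2 * i + 1))) = _
        from funext hval]
      by_cases h0 : e = 0
      · subst h0
        have := uu_sq.mul_left (4 / Real.pi ^ 2)
        have hpi := Real.pi_ne_zero
        simp only [add_zero, if_true]
        refine hs_congr this (fun _ => rfl) ?_
        field_simp
      · rw [if_neg (by omega)]
        simpa using (uu_mul e h0).mul_left (4 / Real.pi ^ 2)
    · intro n hn
      have : ¬ Odd (k - n) := by
        rintro ⟨i, hi⟩
        exact hn ⟨i, by simp only; omega⟩
      simp [rr, this]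

lemma rr_mem (k : ℤ) : Memℓp (fun n => (rr k n : ℂ)) 2 := by
  apply memℓp_gen
  refine (rr_orth k k).summable.congr fun n => ?_
  simp [sq]

noncomputable def RR (k : ℤ) : lp (fun _ : ℤ => ℂ) 2 := ⟨fun n => (rr k n : ℂ), rr_mem k⟩

lemma RR_apply (k n : ℤ) : (RR k : ℤ → ℂ) n = rr k n := rfl

lemma inner_RR (k : ℤ) (a : lp (fun _ : ℤ => ℂ) 2) :
    HasSum (fun n => (rr k n : ℂ) * a n) (inner ℂ (RR k) a) := by
  refine (lp.hasSum_inner (𝕜 := ℂ) (RR k) a).congr_fun ?_ |> id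
  intro n
  simp [RR_apply, mul_comm]

lemma RR_orthonormal : Orthonormal ℂ RR := by
  rw [orthonormal_iff_ite]
  intro k l
  refine (inner_RR k (RR l)).unique ?_
  have := Complex.hasSum_ofReal.mpr (rr_orth k l)
  simp only [RR_apply]
  convert this using 1
  · simp
  · split_ifs <;> simp

lemma Kop_eq (a : ℤ → ℂ) (k : ℤ) : Kop a k = ∑' n, (rr k n : ℂ) * a n := by
  unfold Kop
  split_ifs with hk
  · rw [← tsum_mul_left]
    refine (tsum_subtype {n : ℤ | Even n} (fun n => 2 / (Real.pi : ℂ) * (a n / ((k : ℂ) - (n : ℂ))))).trans ?_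
    refine tsum_congr fun n => ?_
    have : Odd (k - n) ↔ Even n := by rw [Int.odd_sub]; simp [hk]
    by_cases h : Even n
    · simp [rr, this, h]; ring
    · simp [rr, this, h]
  · rw [← tsum_mul_left]
    refine (tsum_subtype {n : ℤ | Odd n} (fun n => 2 / (Real.pi : ℂ) * (a n / ((k : ℂ) - (n : ℂ))))).trans ?_
    refine tsum_congr fun n => ?_
    have : Odd (k - n) ↔ Odd n := by
      rw [Int.odd_sub, ← Int.not_odd_iff_even]; tauto
    by_cases h : Odd n
    · simp only [rr, this, h, Set.indicator, Set.mem_setOf_eq, if_true]; push_cast; ring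
    · simp only [rr, this, h, Set.indicator, Set.mem_setOf_eq, if_false]; simp

lemma Kop_inner (a : lp (fun _ : ℤ => ℂ) 2) (k : ℤ) : Kop a k = inner ℂ (RR k) a := by
  rw [Kop_eq, (inner_RR k a).tsum_eq]

lemma RR_expand (k : ℤ) : HasSum (fun n => (rr k n : ℂ) • RR n) (-lp.single 2 k (1 : ℂ)) := by
  have hs : Summable (fun n => (rr k n : ℂ) • RR n) := by
    have := (RR_orthonormal.orthogonalFamily.summable_iff_norm_sq_summable
      (fun n => (rr k n : ℂ))).2 (by
        refine (rr_orth k k).summable.congr fun n => ?_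
        simp [sq])
    simpa using this
  convert hs.hasSum using 1
  ext m
  have h1 := (hs.hasSum.mapL (lp.evalCLM ℂ (fun _ : ℤ => ℂ) 2 m))
  have h2 := Complex.hasSum_ofReal.mpr (rr_orth k m).neg
  refine HasSum.unique (f := fun n => ((-(rr k n * rr m n) : ℝ) : ℂ))
    (L := SummationFilter.unconditional ℤ) ?_ ?_
  · convert h2 using 1
    by_cases h : k = m
    · subst h; simp
    · simp [h, Pi.single_apply, Ne.symm h]
  · refine h1.congr_fun ?_ |> id
    intro n
    change _ = (rr k n : ℂ) * (rr n m : ℂ)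
    rw [rr_symm m n]
    push_cast
    ring

lemma Kop_Kop (a : lp (fun _ : ℤ => ℂ) 2) (k : ℤ) : Kop (fun j => Kop a j) k = -a k := by
  rw [Kop_eq]
  simp_rw [Kop_inner]
  have h := (RR_expand k).mapL ((innerSL ℂ a : lp (fun _ : ℤ => ℂ) 2 →L[ℂ] ℂ))
  have h2 := Complex.hasSum_conj'.mpr h |>.tsum_eq
  simpa [inner_smul_right, lp.inner_single_right] using h2

lemma Kop_mem (a : lp (fun _ : ℤ => ℂ) 2) : Memℓp (fun k => Kop a k) 2 := by
  apply memℓp_gen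
  simpa [Kop_inner] using RR_orthonormal.inner_products_summable (x := a)

lemma l2norm_eq (a : lp (fun _ : ℤ => ℂ) 2) : l2norm a = ‖a‖ := by
  unfold l2norm
  rw [lp.norm_eq_tsum_rpow (by norm_num), Real.sqrt_eq_rpow]
  simp

lemma Kop_le (a : lp (fun _ : ℤ => ℂ) 2) : l2norm (fun k => Kop a k) ≤ l2norm a := by
  rw [l2norm_eq, l2norm]
  apply Real.sqrt_le_iff.2 ⟨norm_nonneg _, ?_⟩
  simpa [Kop_inner] using RR_orthonormal.tsum_inner_products_le (x := a)

/-- `K∘K = −I` on `ℓ²(ℤ)`, and consequently `K` is an isometry of `ℓ²(ℤ)`. -/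
theorem stmt_16 (a : ℤ → ℂ) (ha : Memℓp a 2) :
    (∀ k : ℤ, Kop (fun j => Kop a j) k = -a k) ∧ l2norm (fun k => Kop a k) = l2norm a := by
  have h1 : ∀ k : ℤ, Kop (fun j => Kop a j) k = -a k := fun k => Kop_Kop ⟨a, ha⟩ k
  refine ⟨h1, le_antisymm (Kop_le ⟨a, ha⟩) ?_⟩
  have h2 : l2norm (fun k => Kop (fun j => Kop a j) k) ≤ l2norm (fun j => Kop a j) :=
    Kop_le ⟨fun j => Kop a j, Kop_mem ⟨a, ha⟩⟩
  have h3 : l2norm (fun k => Kop (fun j => Kop a j) k) = l2norm a := by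
    simp only [l2norm, h1, norm_neg]
  rwa [h3] at h2
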